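/- Let γ ∈ ℂ∖{0}. There exists a U_q(sl₂)-module algebra structure π on ℂ[z^{±1}] with π(k)(z) = γz^{−1} and π(e)(z) = π(f)(z) = 0; moreover, every U_q(sl₂)-module algebra structure π on ℂ[z^{±1}] with π(k)(z) = γz^{−1} satisfies π(e)(w) = 0 and π(f)(w) = 0 for all w ∈ ℂ[z^{±1}]. -/

import Mathlib

/-- A `U_q(sl₂)`-module algebra structure on a unital ℂ-algebra `A`, described via the
actions of the generators `k`, `k⁻¹`, `e`, `f` of `U_q(sl₂)`.  Since `U_q(sl₂)` is generated
as an algebra by `k, k⁻¹, e, f`, an algebra homomorphism `π : U_q(sl₂) → End_ℂ(A)` making `A`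
a module algebra is the same thing as a quadruple of linear endomorphisms satisfying the
defining relations of `U_q(sl₂)` together with the module-algebra conditions coming from the
comultiplication `Δ(k) = k⊗k`, `Δ(e) = 1⊗e + e⊗k`, `Δ(f) = f⊗1 + k⁻¹⊗f` and the counit
`ε(k) = 1`, `ε(e) = ε(f) = 0`. -/
structure UqSl2ModuleAlgebra (q : ℂ) (A : Type*) [Ring A] [Algebra ℂ A] where
  K : A →ₗ[ℂ] A
  Kinv : A →ₗ[ℂ] A
  E : A →ₗ[ℂ] A
  F : A →ₗ[ℂ] A
  K_Kinv : K ∘ₗ Kinv = LinearMap.id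
  Kinv_K : Kinv ∘ₗ K = LinearMap.id
  k_e : K ∘ₗ E = q ^ 2 • (E ∘ₗ K)
  k_f : K ∘ₗ F = (q ^ 2)⁻¹ • (F ∘ₗ K)
  e_f : E ∘ₗ F - F ∘ₗ E = (q - q⁻¹)⁻¹ • (K - Kinv)
  K_mul : ∀ a b : A, K (a * b) = K a * K b
  K_one : K 1 = 1
  E_mul : ∀ a b : A, E (a * b) = a * E b + E a * K b
  E_one : E 1 = 0
  F_mul : ∀ a b : A, F (a * b) = F a * b + Kinv a * F b
  F_one : F 1 = 0

open LaurentPolynomial in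
lemma algHom_eq_id_of_T (φ : LaurentPolynomial ℂ →ₐ[ℂ] LaurentPolynomial ℂ)
    (h : φ (T 1) = T 1) : ∀ w, φ w = w := by
  have hinv : φ (T (-1)) = T (-1) := by
    have h1 : φ (T (-1)) * φ (T 1) = 1 := by
      rw [← map_mul, ← T_add]; simp
    rw [h] at h1
    have h2 : (T 1 : LaurentPolynomial ℂ) * T (-1) = 1 := by
      rw [← T_add]; simp
    calc φ (T (-1)) = φ (T (-1)) * (T 1 * T (-1)) := by rw [h2, mul_one]
      _ = T (-1) := by rw [← mul_assoc, h1, one_mul]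
  have hC : ∀ a : ℂ, φ (C a) = C a := fun a => φ.commutes a
  intro w
  induction w using LaurentPolynomial.induction_on with
  | h_C a => exact hC a
  | h_add hp hq => rw [map_add, hp, hq]
  | h_C_mul_T n a ih =>
    rw [T_add, ← mul_assoc, map_mul, ih, h]
  | h_C_mul_T_Z n a ih =>
    rw [sub_eq_add_neg, T_add, ← mul_assoc, map_mul, ih, hinv]

open LaurentPolynomial in
noncomputable def invHom (γ : ℂ) (hγ : γ ≠ 0) :
    LaurentPolynomial ℂ →ₐ[ℂ] LaurentPolynomial ℂ :=
  AddMonoidAlgebra.lift ℂ (LaurentPolynomial ℂ) ℤ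
    { toFun := fun n => C (γ ^ (Multiplicative.toAdd n)) * T (-(Multiplicative.toAdd n))
      map_one' := by simp
      map_mul' := by
        intro a b
        rw [toAdd_mul, zpow_add₀ hγ, neg_add, T_add, map_mul]
        ring }

open LaurentPolynomial in
lemma invHom_T (γ : ℂ) (hγ : γ ≠ 0) (n : ℤ) :
    invHom γ hγ (T n) = γ ^ n • T (-n) := by
  rw [smul_eq_C_mul]
  refine (AddMonoidAlgebra.lift_single _ n (1 : ℂ)).trans ?_
  rw [one_smul]
  rfl

open LaurentPolynomial in
lemma sq_eq_id (γ : ℂ) (hγ : γ ≠ 0) (φ : LaurentPolynomial ℂ →ₐ[ℂ] LaurentPolynomial ℂ)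
    (h : φ (T 1) = γ • T (-1)) : ∀ w, φ (φ w) = w := by
  apply algHom_eq_id_of_T (φ.comp φ)
  have h1 : φ (T (-1)) * φ (T 1) = 1 := by
    rw [← map_mul, ← T_add]; simp
  have h2 : (T (-1) : LaurentPolynomial ℂ) * T 1 = 1 := by
    rw [← T_add]; simp
  rw [AlgHom.comp_apply, h, map_smul]
  rw [h, mul_smul_comm, ← smul_mul_assoc] at h1
  calc γ • φ (T (-1)) = γ • φ (T (-1)) * (T (-1) * T 1) := by rw [h2, mul_one]
    _ = T 1 := by rw [← mul_assoc, h1, one_mul]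

open LaurentPolynomial in
/-- for `γ ≠ 0` there is a `U_q(sl₂)`-module algebra structure on `ℂ[z^{±1}]`
with `π(k)z = γz⁻¹`, `π(e)z = π(f)z = 0`; and every structure with `π(k)z = γz⁻¹`
has `π(e)` and `π(f)` identically zero. -/
theorem statement3 (q : ℂ) (hq0 : q ≠ 0) (hq : ∀ n : ℤ, n ≠ 0 → q ^ n ≠ 1)
    (γ : ℂ) (hγ : γ ≠ 0) :
    (∃ S : UqSl2ModuleAlgebra q (LaurentPolynomial ℂ),
      S.K (T 1) = γ • T (-1) ∧ S.E (T 1) = 0 ∧ S.F (T 1) = 0) ∧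
    (∀ S : UqSl2ModuleAlgebra q (LaurentPolynomial ℂ),
      S.K (T 1) = γ • T (-1) →
        ∀ w : LaurentPolynomial ℂ, S.E w = 0 ∧ S.F w = 0) := by
  have hq4 : q ^ 4 ≠ 1 := by exact_mod_cast hq 4 (by norm_num)
  constructor
  · have hT : invHom γ hγ (T 1) = γ • T (-1) := by simpa using invHom_T γ hγ 1
    have hs := sq_eq_id γ hγ (invHom γ hγ) hT
    have hs' : (invHom γ hγ).toLinearMap ∘ₗ (invHom γ hγ).toLinearMap = LinearMap.id :=
      LinearMap.ext hs
    exact ⟨{ K := (invHom γ hγ).toLinearMap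
             Kinv := (invHom γ hγ).toLinearMap
             E := 0
             F := 0
             K_Kinv := hs'
             Kinv_K := hs'
             k_e := by simp
             k_f := by simp
             e_f := by simp
             K_mul := fun a b => map_mul (invHom γ hγ) a b
             K_one := map_one (invHom γ hγ)
             E_mul := by simp
             E_one := rfl
             F_mul := by simp
             F_one := rfl }, hT, rfl, rfl⟩
  · intro S hS w
    have hs : ∀ w, S.K (S.K w) = w :=
      sq_eq_id γ hγ (AlgHom.ofLinearMap S.K S.K_one S.K_mul) hS
    have hE : ∀ v, S.K (S.E v) = q ^ 2 • S.E (S.K v) := fun v => LinearMap.congr_fun S.k_e v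
    have hF : ∀ v, S.K (S.F v) = (q ^ 2)⁻¹ • S.F (S.K v) := fun v => LinearMap.congr_fun S.k_f v
    constructor
    · have h := hs (S.E w)
      rw [hE, map_smul, hE, hs, smul_smul] at h
      have h0 : (q ^ 4 - 1) • S.E w = 0 := by
        rw [sub_smul, one_smul, sub_eq_zero]
        convert h using 2
        ring
      exact (smul_eq_zero.mp h0).resolve_left (sub_ne_zero.mpr hq4)
    · have h := hs (S.F w)
      rw [hF, map_smul, hF, hs, smul_smul] at h
      have h0 : ((q ^ 4)⁻¹ - 1) • S.F w = 0 := by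
        rw [sub_smul, one_smul, sub_eq_zero]
        convert h using 2
        rw [← mul_inv]
        ring
      refine (smul_eq_zero.mp h0).resolve_left (sub_ne_zero.mpr ?_)
      rwa [ne_eq, inv_eq_one]
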